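/- arXiv:0708.0887 — 7 statements merged into one kernel-verified Lean document; each statement's English description precedes it below -/
import Mathlib

section
/- Let r : [a,b] → (0,∞) be C¹ with enclosed volume V = σ ∫_a^b β(r(z)) dz, and define r₁ > 0 by β(r₁) = V/((b−a)·σ). Then the area satisfies the strict inequality A(r) > σ·(δ(max_{[a,b]} r) − δ(r₁)). Consequently, for any A₀ ≥ A(r), if r₂ > r₁ is defined by δ(r₂) = A₀/σ + δ(r₁), then max_{z∈[a,b]} r(z) < r₂. -/
open Real Set MeasureTheory Filter

/-- β(s) = ∫₀^s f(ρ) h(ρ)^{n−1} dρ -/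
noncomputable def sBeta (n : ℕ) (f h : ℝ → ℝ) (s : ℝ) : ℝ :=
  ∫ ρ in (0:ℝ)..s, f ρ * h ρ ^ (n - 1)

/-- δ(s) = ∫₀^s h(ρ)^{n−1} dρ -/
noncomputable def sDelta (n : ℕ) (h : ℝ → ℝ) (s : ℝ) : ℝ :=
  ∫ ρ in (0:ℝ)..s, h ρ ^ (n - 1)

/-- The n-volume (area) of the revolution hypersurface generated by the graph of r. -/
noncomputable def area (n : ℕ) (f h : ℝ → ℝ) (σ a b : ℝ) (r : ℝ → ℝ) : ℝ :=
  σ * ∫ z in a..b, Real.sqrt ((deriv r z) ^ 2 + (f (r z)) ^ 2) * h (r z) ^ (n - 1)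

/-- The (n+1)-volume enclosed by the revolution hypersurface generated by the graph of r. -/
noncomputable def encVol (n : ℕ) (f h : ℝ → ℝ) (σ a b : ℝ) (r : ℝ → ℝ) : ℝ :=
  σ * ∫ z in a..b, sBeta n f h (r z)

/-- The averaged mean curvature H̄ of the revolution hypersurface generated by the graph of r. -/
noncomputable def avgH (n : ℕ) (f h : ℝ → ℝ) (σ a b : ℝ) (r : ℝ → ℝ) : ℝ :=
  (σ / area n f h σ a b r) *
    ∫ z in a..b,
      (-(deriv (fun w => Real.arctan (deriv r w / f (r w))) z)
        + (((n : ℝ) - 1) * deriv h (r z) * f (r z) + deriv f (r z) * h (r z)) / h (r z))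
        * h (r z) ^ (n - 1)

theorem hasDerivAt_integral_zero {g : ℝ → ℝ} (hg : Continuous g) (s : ℝ) :
    HasDerivAt (fun u => ∫ ρ in (0:ℝ)..u, g ρ) (g s) s :=
  intervalIntegral.integral_hasDerivAt_right (hg.intervalIntegrable _ _)
    hg.aestronglyMeasurable.stronglyMeasurableAtFilter hg.continuousAt

theorem strictMonoOn_integral_zero {g : ℝ → ℝ} (hg : Continuous g)
    (hpos : ∀ s : ℝ, 0 < s → 0 < g s) :
    StrictMonoOn (fun u => ∫ ρ in (0:ℝ)..u, g ρ) (Ici 0) := by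
  refine strictMonoOn_of_deriv_pos (convex_Ici 0)
    (fun s _ => (hasDerivAt_integral_zero hg s).continuousAt.continuousWithinAt) fun s hs => ?_
  rw [interior_Ici] at hs
  rw [(hasDerivAt_integral_zero hg s).deriv]
  exact hpos s hs

/-- A continuous function on `[a, b]` attains its average value. -/
theorem exists_mem_Icc_integral_eq_mul {u : ℝ → ℝ} (hu : Continuous u) {a b : ℝ} (hab : a < b) :
    ∃ z ∈ Icc a b, ∫ x in a..b, u x = u z * (b - a) := by
  have hd : ∀ s, HasDerivAt (fun t => ∫ x in a..t, u x) (u s) s := fun s =>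
    intervalIntegral.integral_hasDerivAt_right (hu.intervalIntegrable _ _)
      hu.aestronglyMeasurable.stronglyMeasurableAtFilter hu.continuousAt
  obtain ⟨c, hc, h⟩ := exists_hasDerivAt_eq_slope _ u hab
    (fun s _ => (hd s).continuousAt.continuousWithinAt) fun s _ => hd s
  refine ⟨c, Ioo_subset_Icc_self hc, ?_⟩
  rw [h, intervalIntegral.integral_same, sub_zero, div_mul_cancel₀ _ (sub_pos.2 hab).ne']

/-- The oscillation of a `C¹` function is at most its total variation. -/
theorem sub_le_integral_abs_deriv {F F' : ℝ → ℝ} (hF : ∀ z, HasDerivAt F (F' z) z)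
    (hF' : Continuous F') {a b x y : ℝ} (hx : x ∈ Icc a b) (hy : y ∈ Icc a b) :
    F y - F x ≤ ∫ z in a..b, |F' z| := by
  have hab : a ≤ b := hx.1.trans hx.2
  rw [← intervalIntegral.integral_eq_sub_of_hasDerivAt (fun z _ => hF z)
    (hF'.intervalIntegrable _ _)]
  calc ∫ z in x..y, F' z ≤ |∫ z in x..y, F' z| := le_abs_self _
    _ ≤ |(∫ z in x..y, |F' z|)| := by
        simpa only [Real.norm_eq_abs] using
          intervalIntegral.norm_integral_le_abs_integral_norm (f := F') (a := x) (b := y)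
    _ ≤ |(∫ z in a..b, |F' z|)| := by
        refine intervalIntegral.abs_integral_mono_interval ?_
          (Eventually.of_forall fun z => abs_nonneg _) (hF'.abs.intervalIntegrable _ _)
        rw [uIoc_of_le hab]
        exact Ioc_subset_Ioc (le_min hx.1 hy.1) (max_le hx.2 hy.2)
    _ = ∫ z in a..b, |F' z| :=
        abs_of_nonneg (intervalIntegral.integral_nonneg hab fun z _ => abs_nonneg _)

/-- If r : [a,b] → (0,∞) is C¹ with enclosed volume V and β(r₁) = V/((b−a)σ), then
A(r) > σ(δ(max r) − δ(r₁)); consequently, if A(r) ≤ A₀ and δ(r₂) = A₀/σ + δ(r₁) with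
r₂ > r₁, then max r < r₂. -/
theorem stmt_2 (n : ℕ) (hn : 2 ≤ n) (f h : ℝ → ℝ)
    (hf : ContDiff ℝ (⊤ : ℕ∞) f) (hh : ContDiff ℝ (⊤ : ℕ∞) h)
    (hfpos : ∀ s : ℝ, 0 ≤ s → 0 < f s) (hhpos : ∀ s : ℝ, 0 < s → 0 < h s)
    (hf0 : f 0 = 1) (hf'0 : deriv f 0 = 0) (hh0 : h 0 = 0) (hh'0 : deriv h 0 = 1)
    (σ : ℝ) (hσ : 0 < σ) (a b : ℝ) (hab : a < b)
    (r : ℝ → ℝ) (hr : ContDiff ℝ 1 r)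
    (hrpos : ∀ z ∈ Set.Icc a b, 0 < r z)
    (V r₁ : ℝ) (hV : V = encVol n f h σ a b r)
    (hr₁pos : 0 < r₁) (hr₁ : sBeta n f h r₁ = V / ((b - a) * σ)) :
    σ * (sDelta n h (sSup (r '' Set.Icc a b)) - sDelta n h r₁) < area n f h σ a b r
    ∧ ∀ A₀ r₂ : ℝ, area n f h σ a b r ≤ A₀ → r₁ < r₂ →
        sDelta n h r₂ = A₀ / σ + sDelta n h r₁ →
        sSup (r '' Set.Icc a b) < r₂ := by
  have hcr := hr.continuous
  have hcr' : Continuous (deriv r) := hr.continuous_deriv le_rfl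
  have hch := hh.continuous
  have hcf := hf.continuous
  have hδc : Continuous fun s => h s ^ (n - 1) := hch.pow _
  have hβc : Continuous fun s => f s * h s ^ (n - 1) := hcf.mul hδc
  have hβmono : StrictMonoOn (sBeta n f h) (Ici 0) := strictMonoOn_integral_zero hβc
    fun s hs => mul_pos (hfpos s hs.le) (pow_pos (hhpos s hs) _)
  have hδmono : StrictMonoOn (sDelta n h) (Ici 0) := strictMonoOn_integral_zero hδc
    fun s hs => pow_pos (hhpos s hs) _
  have hβcont : Continuous (sBeta n f h) :=
    continuous_iff_continuousAt.2 fun s => (hasDerivAt_integral_zero hβc s).continuousAt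
  have hba : 0 < b - a := sub_pos.2 hab
  obtain ⟨z₁, hz₁, hz₁r⟩ : ∃ z ∈ Icc a b, r z = r₁ := by
    obtain ⟨z, hz, hzeq⟩ := exists_mem_Icc_integral_eq_mul (hβcont.comp hcr) hab
    refine ⟨z, hz, hβmono.injOn (hrpos z hz).le hr₁pos.le ?_⟩
    simp only [Function.comp_apply] at hzeq
    rw [hr₁, hV, encVol, hzeq]
    field_simp
  obtain ⟨z₂, hz₂, hz₂r, -⟩ :=
    isCompact_Icc.exists_sSup_image_eq_and_ge (nonempty_Icc.2 hab.le) hcr.continuousOn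
  have hderiv : ∀ z, HasDerivAt (fun z => sDelta n h (r z)) (h (r z) ^ (n - 1) * deriv r z) z :=
    fun z => (hasDerivAt_integral_zero hδc (r z)).comp z
      (hr.differentiable one_ne_zero z).hasDerivAt
  have hstrict : ∀ z ∈ Icc a b, |h (r z) ^ (n - 1) * deriv r z| <
      √(deriv r z ^ 2 + f (r z) ^ 2) * h (r z) ^ (n - 1) := by
    intro z hz
    have hp : 0 < h (r z) ^ (n - 1) := pow_pos (hhpos _ (hrpos z hz)) _
    rw [abs_mul, abs_of_pos hp, mul_comm]
    refine mul_lt_mul_of_pos_right ?_ hp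
    rw [← Real.sqrt_sq_eq_abs]
    exact Real.sqrt_lt_sqrt (sq_nonneg _)
      (lt_add_of_pos_right _ (pow_pos (hfpos _ (hrpos z hz).le) 2))
  have hmain : sDelta n h (sSup (r '' Icc a b)) - sDelta n h r₁ <
      ∫ z in a..b, √(deriv r z ^ 2 + f (r z) ^ 2) * h (r z) ^ (n - 1) := by
    rw [hz₂r, ← hz₁r]
    refine (sub_le_integral_abs_deriv hderiv (by fun_prop) hz₁ hz₂).trans_lt ?_
    exact intervalIntegral.integral_lt_integral_of_continuousOn_of_le_of_exists_lt hab
      (by fun_prop) (by fun_prop) (fun z hz => (hstrict z (Ioc_subset_Icc_self hz)).le)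
      ⟨a, left_mem_Icc.2 hab.le, hstrict a (left_mem_Icc.2 hab.le)⟩
  have harea : σ * (sDelta n h (sSup (r '' Icc a b)) - sDelta n h r₁) < area n f h σ a b r :=
    mul_lt_mul_of_pos_left hmain hσ
  refine ⟨harea, fun A₀ r₂ hA hr₁₂ hr₂ => ?_⟩
  have hM : 0 ≤ sSup (r '' Icc a b) := hz₂r ▸ (hrpos z₂ hz₂).le
  refine (hδmono.lt_iff_lt hM (hr₁pos.trans hr₁₂).le).1 ?_
  rw [hr₂, ← sub_lt_iff_lt_add, lt_div_iff₀' hσ]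
  exact harea.trans_le hA
end

section
/- Let 0 < ρ ≤ 𝔯 be such that h' > 0 and (n−1)·h'·f + f'·h > 0 on (0, 𝔯]. Let r : [a,b] → [ρ, 𝔯] be C² with r'(a) = r'(b) = 0. Then the averaged mean curvature satisfies 0 ≤ H̄(r) ≤ h₂, where h₂ = (π/2)·max_{s∈[ρ,𝔯]} [(n−1) h'(s)/h(s)] + max_{s∈[ρ,𝔯]} [((n−1) h'(s) f(s) + f'(s) h(s))/(f(s) h(s))]. -/
open Real Set MeasureTheory Filter

theorem mul_arctan_div_nonneg {y c : ℝ} (hc : 0 < c) : 0 ≤ y * Real.arctan (y / c) := by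
  rcases le_total 0 y with hy | hy
  · exact mul_nonneg hy (Real.arctan_nonneg.2 (div_nonneg hy hc.le))
  · exact mul_nonneg_of_nonpos_of_nonpos hy
      (Real.arctan_le_zero.2 (div_nonpos_of_nonpos_of_nonneg hy hc.le))

theorem mul_arctan_div_le (y c : ℝ) :
    y * Real.arctan (y / c) ≤ Real.pi / 2 * Real.sqrt (y ^ 2 + c ^ 2) := by
  have harctan : |Real.arctan (y / c)| ≤ Real.pi / 2 :=
    abs_le.2 ⟨(Real.neg_pi_div_two_lt_arctan _).le, (Real.arctan_lt_pi_div_two _).le⟩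
  have hy : |y| ≤ Real.sqrt (y ^ 2 + c ^ 2) :=
    Real.abs_le_sqrt (le_add_of_nonneg_right (sq_nonneg c))
  calc y * Real.arctan (y / c) ≤ |y| * |Real.arctan (y / c)| := by
        rw [← abs_mul]; exact le_abs_self _
    _ ≤ Real.sqrt (y ^ 2 + c ^ 2) * (Real.pi / 2) := by gcongr
    _ = _ := mul_comm _ _

/-- Integration by parts for the arctangent term of the averaged mean curvature, when the
boundary slopes vanish. -/
theorem integral_neg_deriv_arctan_mul {a b : ℝ} {f r P P' : ℝ → ℝ} (hab : a ≤ b)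
    (hf : ContDiff ℝ 1 f) (hr : ContDiff ℝ 2 r) (hfr : ∀ z ∈ Set.Icc a b, 0 < f (r z))
    (hra : deriv r a = 0) (hrb : deriv r b = 0)
    (hP : ∀ z ∈ Set.Icc a b, HasDerivAt P (P' z) z) (hP' : ContinuousOn P' (Set.Icc a b)) :
    IntervalIntegrable
        (fun z => -(deriv (fun w => Real.arctan (deriv r w / f (r w))) z) * P z) volume a b ∧
      ∫ z in a..b, -(deriv (fun w => Real.arctan (deriv r w / f (r w))) z) * P z =
        ∫ z in a..b, Real.arctan (deriv r z / f (r z)) * P' z := by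
  set g : ℝ → ℝ := fun w => Real.arctan (deriv r w / f (r w)) with hg
  have hr1 : ContDiff ℝ 1 (deriv r) := ((contDiff_succ_iff_deriv (n := 1)).1 hr).2.2
  have hfr1 : ContDiff ℝ 1 (fun w => f (r w)) := hf.comp (hr.of_le (by norm_num))
  have hU : IsOpen {w | 0 < f (r w)} := isOpen_lt continuous_const hfr1.continuous
  have hgU : ContDiffOn ℝ 1 g {w | 0 < f (r w)} :=
    Real.contDiff_arctan.comp_contDiffOn
      (hr1.contDiffOn.div hfr1.contDiffOn fun w hw => ne_of_gt hw)
  have hsub : Set.Icc a b ⊆ {w | 0 < f (r w)} := hfr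
  have hg' : ContinuousOn (deriv g) (Set.Icc a b) :=
    (hgU.continuousOn_deriv_of_isOpen hU le_rfl).mono hsub
  have hgd : ∀ z ∈ Set.Icc a b, HasDerivAt g (deriv g z) z := fun z hz =>
    ((hgU.differentiableOn one_ne_zero).differentiableAt (hU.mem_nhds (hsub hz))).hasDerivAt
  have hPc : ContinuousOn P (Set.Icc a b) := fun z hz =>
    (hP z hz).continuousAt.continuousWithinAt
  have hparts := intervalIntegral.integral_mul_deriv_eq_deriv_mul (u := g) (v := P)
    (u' := deriv g) (v' := P') (a := a) (b := b)
    (by rwa [Set.uIcc_of_le hab]) (by rwa [Set.uIcc_of_le hab])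
    (hg'.intervalIntegrable_of_Icc hab) (hP'.intervalIntegrable_of_Icc hab)
  refine ⟨(hg'.neg.mul hPc).intervalIntegrable_of_Icc hab, ?_⟩
  rw [hparts]
  simp [hg, hra, hrb]

/-- Rough bounds for the averaged mean curvature: 0 ≤ H̄(r) ≤ h₂ when ρ ≤ r ≤ 𝔯 and
h' > 0, (n−1)h'f + f'h > 0 on (0,𝔯]. -/
theorem stmt_7 (n : ℕ) (hn : 2 ≤ n) (f h : ℝ → ℝ)
    (hf : ContDiff ℝ (⊤ : ℕ∞) f) (hh : ContDiff ℝ (⊤ : ℕ∞) h)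
    (hfpos : ∀ s : ℝ, 0 ≤ s → 0 < f s) (hhpos : ∀ s : ℝ, 0 < s → 0 < h s)
    (hf0 : f 0 = 1) (hf'0 : deriv f 0 = 0) (hh0 : h 0 = 0) (hh'0 : deriv h 0 = 1)
    (σ : ℝ) (hσ : 0 < σ) (a b : ℝ) (hab : a < b)
    (ρ 𝔯 : ℝ) (hρ : 0 < ρ) (hρ𝔯 : ρ ≤ 𝔯)
    (hh' : ∀ s ∈ Set.Ioc (0:ℝ) 𝔯, 0 < deriv h s)
    (hmix : ∀ s ∈ Set.Ioc (0:ℝ) 𝔯, 0 < ((n : ℝ) - 1) * deriv h s * f s + deriv f s * h s)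
    (r : ℝ → ℝ) (hr : ContDiff ℝ 2 r)
    (hrange : ∀ z ∈ Set.Icc a b, r z ∈ Set.Icc ρ 𝔯)
    (hra : deriv r a = 0) (hrb : deriv r b = 0) :
    0 ≤ avgH n f h σ a b r
    ∧ avgH n f h σ a b r ≤
        (Real.pi / 2) * sSup ((fun s => ((n : ℝ) - 1) * deriv h s / h s) '' Set.Icc ρ 𝔯)
        + sSup ((fun s => (((n : ℝ) - 1) * deriv h s * f s + deriv f s * h s) / (f s * h s))
            '' Set.Icc ρ 𝔯) := by
  have hn1 : (0 : ℝ) < (n : ℝ) - 1 := by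
    have : (2 : ℝ) ≤ n := by exact_mod_cast hn
    linarith
  have hrc : Continuous r := hr.continuous
  have hr'c : Continuous (deriv r) := hr.continuous_deriv (by norm_num)
  have hfc : Continuous f := hf.continuous
  have hhc : Continuous h := hh.continuous
  have hf'c : Continuous (deriv f) := hf.continuous_deriv (by simp)
  have hh'c : Continuous (deriv h) := hh.continuous_deriv (by simp)
  have hrd : Differentiable ℝ r := hr.differentiable (by norm_num)
  have hhd : Differentiable ℝ h := hh.differentiable (by simp)
  have hspos : ∀ s ∈ Set.Icc ρ 𝔯, 0 < s := fun s hs => hρ.trans_le hs.1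
  have hfr : ∀ z ∈ Set.Icc a b, 0 < f (r z) := fun z hz =>
    hfpos _ (hspos _ (hrange z hz)).le
  have hhr : ∀ z ∈ Set.Icc a b, 0 < h (r z) := fun z hz =>
    hhpos _ (hspos _ (hrange z hz))
  have hIoc : ∀ s ∈ Set.Icc ρ 𝔯, s ∈ Set.Ioc (0 : ℝ) 𝔯 := fun s hs => ⟨hspos s hs, hs.2⟩
  have hpow : ∀ z, h (r z) ^ (n - 1) = h (r z) ^ (n - 2) * h (r z) := fun z => by
    rw [← pow_succ]; congr 1; omega
  set M₁ := sSup ((fun s => ((n : ℝ) - 1) * deriv h s / h s) '' Set.Icc ρ 𝔯)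
  set M₂ := sSup ((fun s => (((n : ℝ) - 1) * deriv h s * f s + deriv f s * h s) / (f s * h s))
            '' Set.Icc ρ 𝔯)
  have hM₁ : ∀ s ∈ Set.Icc ρ 𝔯, ((n : ℝ) - 1) * deriv h s / h s ≤ M₁ := fun s hs =>
    ContinuousOn.le_sSup_image_Icc
      (f := fun s => ((n : ℝ) - 1) * deriv h s / h s)
      (ContinuousOn.div (by fun_prop) (by fun_prop) fun s hs => (hhpos s (hspos s hs)).ne') hs
  have hM₂ : ∀ s ∈ Set.Icc ρ 𝔯,
      (((n : ℝ) - 1) * deriv h s * f s + deriv f s * h s) / (f s * h s) ≤ M₂ := fun s hs =>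
    ContinuousOn.le_sSup_image_Icc
      (f := fun s => (((n : ℝ) - 1) * deriv h s * f s + deriv f s * h s) / (f s * h s))
      (ContinuousOn.div (by fun_prop) (by fun_prop) fun s hs =>
        (mul_pos (hfpos s (hspos s hs).le) (hhpos s (hspos s hs))).ne') hs
  set P' : ℝ → ℝ := fun z => ((n : ℝ) - 1) * h (r z) ^ (n - 2) * (deriv h (r z) * deriv r z)
    with hP'def
  have hP : ∀ z, HasDerivAt (fun w => h (r w) ^ (n - 1)) (P' z) z := fun z => by
    have hd := (((hhd (r z)).hasDerivAt).comp z (hrd z).hasDerivAt).pow (n - 1)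
    refine hd.congr_deriv ?_
    rw [hP'def, Nat.cast_sub (by omega), Nat.sub_sub]
    simp
  have hP'c : Continuous P' := by fun_prop
  obtain ⟨hint₁, hparts⟩ := integral_neg_deriv_arctan_mul hab.le
    (hf.of_le (by exact_mod_cast le_top)) hr hfr hra hrb (fun z _ => hP z) hP'c.continuousOn
  set mix : ℝ → ℝ := fun z =>
    (((n : ℝ) - 1) * deriv h (r z) * f (r z) + deriv f (r z) * h (r z)) / h (r z)
      * h (r z) ^ (n - 1) with hmixdef
  have hmixint : IntervalIntegrable mix volume a b := by
    refine ContinuousOn.intervalIntegrable_of_Icc hab.le (ContinuousOn.mul ?_ (by fun_prop))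
    exact ContinuousOn.div (by fun_prop) (by fun_prop) fun z hz => (hhr z hz).ne'
  have hangleint : IntervalIntegrable
      (fun z => Real.arctan (deriv r z / f (r z)) * P' z) volume a b := by
    refine ContinuousOn.intervalIntegrable_of_Icc hab.le
      (ContinuousOn.mul (Real.continuous_arctan.comp_continuousOn ?_) hP'c.continuousOn)
    exact ContinuousOn.div (by fun_prop) (by fun_prop) fun z hz => (hfr z hz).ne'
  set S : ℝ → ℝ := fun z =>
    Real.sqrt ((deriv r z) ^ 2 + (f (r z)) ^ 2) * h (r z) ^ (n - 1) with hSdef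
  have hSc : Continuous S := by fun_prop
  have hSpos : 0 < ∫ z in a..b, S z := by
    refine intervalIntegral.intervalIntegral_pos_of_pos_on (hSc.intervalIntegrable _ _)
      (fun z hz => ?_) hab
    have := hfr z (Set.Ioo_subset_Icc_self hz)
    have := hhr z (Set.Ioo_subset_Icc_self hz)
    positivity
  have havg : avgH n f h σ a b r =
      (∫ z in a..b, (Real.arctan (deriv r z / f (r z)) * P' z + mix z)) / ∫ z in a..b, S z := by
    have hsplit : (∫ z in a..b,
        (-(deriv (fun w => Real.arctan (deriv r w / f (r w))) z)
          + (((n : ℝ) - 1) * deriv h (r z) * f (r z) + deriv f (r z) * h (r z)) / h (r z))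
          * h (r z) ^ (n - 1)) =
        ∫ z in a..b, (Real.arctan (deriv r z / f (r z)) * P' z + mix z) := by
      simp only [add_mul]
      rw [intervalIntegral.integral_add hint₁ hmixint, hparts,
        intervalIntegral.integral_add hangleint hmixint]
    rw [avgH, hsplit, area, ← div_div, div_self hσ.ne', one_div_mul_eq_div]
  have hangle : ∀ z ∈ Set.Icc a b, Real.arctan (deriv r z / f (r z)) * P' z =
      deriv r z * Real.arctan (deriv r z / f (r z)) *
        ((((n : ℝ) - 1) * deriv h (r z) / h (r z)) * h (r z) ^ (n - 1)) := fun z hz => by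
    have := (hhr z hz).ne'
    rw [hP'def, hpow]
    field_simp
  have hbounds : ∀ z ∈ Set.Icc a b,
      0 ≤ Real.arctan (deriv r z / f (r z)) * P' z + mix z ∧
      Real.arctan (deriv r z / f (r z)) * P' z + mix z ≤ (Real.pi / 2 * M₁ + M₂) * S z := by
    intro z hz
    have hf0 := hfr z hz
    have hh0 := hhr z hz
    have hd0 := hh' _ (hIoc _ (hrange z hz))
    have hm0 := hmix _ (hIoc _ (hrange z hz))
    have hy0 := mul_arctan_div_nonneg (y := deriv r z) hf0
    have hm : mix z = (((n : ℝ) - 1) * deriv h (r z) * f (r z) + deriv f (r z) * h (r z))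
        / (f (r z) * h (r z)) * (f (r z) * h (r z) ^ (n - 1)) := by
      rw [hmixdef]
      field_simp
    rw [hangle z hz, hm]
    refine ⟨by positivity, ?_⟩
    have hle₁ := hM₁ _ (hrange z hz)
    have hle₂ := hM₂ _ (hrange z hz)
    have hM₂0 : 0 ≤ M₂ := le_trans (by positivity) hle₂
    have hfS : f (r z) ≤ Real.sqrt ((deriv r z) ^ 2 + (f (r z)) ^ 2) :=
      Real.le_sqrt_of_sq_le (le_add_of_nonneg_left (sq_nonneg _))
    calc _ ≤ Real.pi / 2 * Real.sqrt ((deriv r z) ^ 2 + (f (r z)) ^ 2) *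
            (M₁ * h (r z) ^ (n - 1)) +
          M₂ * (Real.sqrt ((deriv r z) ^ 2 + (f (r z)) ^ 2) * h (r z) ^ (n - 1)) := by
          refine add_le_add ?_ ?_
          · exact mul_le_mul (mul_arctan_div_le _ _) (by gcongr) (by positivity) (by positivity)
          · gcongr
      _ = _ := by rw [hSdef]; ring
  rw [havg]
  constructor
  · exact div_nonneg (intervalIntegral.integral_nonneg hab.le fun z hz => (hbounds z hz).1)
      hSpos.le
  · rw [div_le_iff₀ hSpos, ← intervalIntegral.integral_const_mul]
    exact intervalIntegral.integral_mono_on hab.le (hangleint.add hmixint)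
      ((hSc.intervalIntegrable _ _).const_mul _) fun z hz => (hbounds z hz).2
end

section
/- Assume h'' ≥ 0 and f'·h' ≥ 0 on [0,∞) (i.e. the ambient sectional curvatures S_ri and S_zi are non-positive). Let 0 < ρ ≤ r₂ and A₀ > 0, and let r : [a,b] → [ρ, r₂] be C² with r'(a) = r'(b) = 0 and area A(r) ≤ A₀. Then the averaged mean curvature has the positive lower bound H̄(r) ≥ σ·(b−a)·(n−1)·h'(ρ)·h(ρ)^{n−2} / A₀ > 0. -/
open Real Set MeasureTheory Filter

theorem arctan_div_mul_self_nonneg {x y : ℝ} (hy : 0 < y) : 0 ≤ Real.arctan (x / y) * x := by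
  rcases le_total 0 x with hx | hx
  · exact mul_nonneg (Real.arctan_nonneg.2 (div_nonneg hx hy.le)) hx
  · exact mul_nonneg_of_nonpos_of_nonpos
      (Real.arctan_zero ▸ Real.arctan_mono (div_nonpos_of_nonpos_of_nonneg hx hy.le)) hx

theorem monotoneOn_Ici_of_deriv_nonneg {g : ℝ → ℝ} (hg : Differentiable ℝ g)
    (hg' : ∀ s : ℝ, 0 ≤ s → 0 ≤ deriv g s) : MonotoneOn g (Set.Ici 0) :=
  monotoneOn_of_deriv_nonneg (convex_Ici 0) hg.continuous.continuousOn hg.differentiableOn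
    fun s hs => hg' s (interior_subset hs)

/-- If `θ` vanishes at both endpoints, a function bounded below by `C - (θ * H)'` has integral at
least `C * (b - a)`. -/
theorem const_mul_sub_le_integral_of_sub_deriv_le {θ θ' H H' G : ℝ → ℝ} {a b C : ℝ} (hab : a ≤ b)
    (hθ : ∀ z ∈ Set.Icc a b, HasDerivAt θ (θ' z) z)
    (hH : ∀ z ∈ Set.Icc a b, HasDerivAt H (H' z) z)
    (hθ' : ContinuousOn θ' (Set.Icc a b)) (hH' : ContinuousOn H' (Set.Icc a b))
    (hG : ContinuousOn G (Set.Icc a b)) (ha : θ a = 0) (hb : θ b = 0)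
    (hle : ∀ z ∈ Set.Icc a b, C - (θ' z * H z + θ z * H' z) ≤ G z) :
    C * (b - a) ≤ ∫ z in a..b, G z := by
  have hθc : ContinuousOn θ (Set.Icc a b) := fun z hz => (hθ z hz).continuousAt.continuousWithinAt
  have hHc : ContinuousOn H (Set.Icc a b) := fun z hz => (hH z hz).continuousAt.continuousWithinAt
  have hint : IntervalIntegrable (fun z => θ' z * H z + θ z * H' z) volume a b :=
    ((hθ'.mul hHc).add (hθc.mul hH')).intervalIntegrable_of_Icc hab
  have hzero : ∫ z in a..b, (θ' z * H z + θ z * H' z) = 0 := by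
    rw [intervalIntegral.integral_eq_sub_of_hasDerivAt (f := fun z => θ z * H z) _ hint]
    · simp [ha, hb]
    · intro z hz
      rw [Set.uIcc_of_le hab] at hz
      exact (hθ z hz).mul (hH z hz)
  calc C * (b - a) = ∫ z in a..b, (C - (θ' z * H z + θ z * H' z)) := by
        rw [intervalIntegral.integral_sub intervalIntegrable_const hint, hzero]
        simp [mul_comm]
    _ ≤ ∫ z in a..b, G z := intervalIntegral.integral_mono_on hab
        (intervalIntegrable_const.sub hint) (hG.intervalIntegrable_of_Icc hab) hle

/-- Positive lower bound for the averaged mean curvature when S_ri ≤ 0 and S_zi ≤ 0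
(h'' ≥ 0 and f'·h' ≥ 0), ρ ≤ r ≤ r₂ and A(r) ≤ A₀. -/
theorem stmt_8 (n : ℕ) (hn : 2 ≤ n) (f h : ℝ → ℝ)
    (hf : ContDiff ℝ (⊤ : ℕ∞) f) (hh : ContDiff ℝ (⊤ : ℕ∞) h)
    (hfpos : ∀ s : ℝ, 0 ≤ s → 0 < f s) (hhpos : ∀ s : ℝ, 0 < s → 0 < h s)
    (hf0 : f 0 = 1) (hf'0 : deriv f 0 = 0) (hh0 : h 0 = 0) (hh'0 : deriv h 0 = 1)
    (σ : ℝ) (hσ : 0 < σ) (a b : ℝ) (hab : a < b)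
    (hSri : ∀ s : ℝ, 0 ≤ s → 0 ≤ deriv (deriv h) s)
    (hSzi : ∀ s : ℝ, 0 ≤ s → 0 ≤ deriv f s * deriv h s)
    (ρ r₂ A₀ : ℝ) (hρ : 0 < ρ) (hρr₂ : ρ ≤ r₂) (hA₀ : 0 < A₀)
    (r : ℝ → ℝ) (hr : ContDiff ℝ 2 r)
    (hrange : ∀ z ∈ Set.Icc a b, r z ∈ Set.Icc ρ r₂)
    (hra : deriv r a = 0) (hrb : deriv r b = 0)
    (harea : area n f h σ a b r ≤ A₀) :
    σ * (b - a) * ((n : ℝ) - 1) * deriv h ρ * h ρ ^ (n - 2) / A₀ ≤ avgH n f h σ a b r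
    ∧ 0 < σ * (b - a) * ((n : ℝ) - 1) * deriv h ρ * h ρ ^ (n - 2) / A₀ := by
  obtain ⟨m, rfl⟩ := Nat.exists_eq_add_of_le' hn
  have hcast : ((m + 2 : ℕ) : ℝ) - 1 = m + 1 := by push_cast; ring
  have hpred : m + 2 - 1 = m + 1 := rfl
  have hfd : Differentiable ℝ f := hf.differentiable (by simp)
  have hhd : Differentiable ℝ h := hh.differentiable (by simp)
  have hrd : Differentiable ℝ r := hr.differentiable (by simp)
  have hfc' : Continuous (deriv f) := hf.continuous_deriv (by simp)
  have hhc' : Continuous (deriv h) := hh.continuous_deriv (by simp)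
  have hr' : ContDiff ℝ 1 (deriv r) := ContDiff.deriv' (n := 1) hr
  have hhd' : Differentiable ℝ (deriv h) :=
    (ContDiff.deriv' (n := (⊤ : ℕ∞)) hh).differentiable (by simp)
  have hmono_h' : MonotoneOn (deriv h) (Set.Ici 0) := monotoneOn_Ici_of_deriv_nonneg hhd' hSri
  have hh'1 : ∀ s : ℝ, 0 ≤ s → 1 ≤ deriv h s := fun s hs =>
    hh'0 ▸ hmono_h' Set.self_mem_Ici hs hs
  have hmono_h : MonotoneOn h (Set.Ici 0) :=
    monotoneOn_Ici_of_deriv_nonneg hhd fun s hs => zero_le_one.trans (hh'1 s hs)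
  have hf' : ∀ s : ℝ, 0 ≤ s → 0 ≤ deriv f s := fun s hs =>
    nonneg_of_mul_nonneg_left (hSzi s hs) (zero_lt_one.trans_le (hh'1 s hs))
  have hf1 : ∀ s : ℝ, 0 ≤ s → 1 ≤ f s := fun s hs =>
    hf0 ▸ monotoneOn_Ici_of_deriv_nonneg hfd hf' Set.self_mem_Ici hs hs
  have hrpos : ∀ z ∈ Set.Icc a b, 0 < r z := fun z hz => hρ.trans_le (hrange z hz).1
  have hfr : ∀ z ∈ Set.Icc a b, 0 < f (r z) := fun z hz => hfpos _ (hrpos z hz).le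
  have hhr : ∀ z ∈ Set.Icc a b, 0 < h (r z) := fun z hz => hhpos _ (hrpos z hz)
  have hfrc : Continuous fun z => f (r z) := hf.continuous.comp hr.continuous
  have hhrc : Continuous fun z => h (r z) := hh.continuous.comp hr.continuous
  have hhρ : 0 < h ρ := hhpos ρ hρ
  have hh'ρ : 0 < deriv h ρ := zero_lt_one.trans_le (hh'1 ρ hρ.le)
  have hApos : 0 < area (m + 2) f h σ a b r := by
    refine mul_pos hσ (intervalIntegral.intervalIntegral_pos_of_pos_on ?_ ?_ hab)
    · refine Continuous.intervalIntegrable ?_ _ _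
      exact (((hr'.continuous.pow 2).add (hfrc.pow 2)).sqrt).mul (hhrc.pow _)
    · intro z hz
      have hz' := Set.Ioo_subset_Icc_self hz
      have := hfr z hz'
      have := hhr z hz'
      positivity
  set θ : ℝ → ℝ := fun w => Real.arctan (deriv r w / f (r w)) with hθdef
  have hopen : IsOpen {z | 0 < f (r z)} := isOpen_lt continuous_const hfrc
  have hθ : ContDiffOn ℝ 1 θ {z | 0 < f (r z)} :=
    (hr'.contDiffOn.div (((hf.of_le (by exact_mod_cast le_top)).comp
      (hr.of_le (by norm_num))).contDiffOn) fun _ hz => ne_of_gt hz).arctan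
  have hbound : (((m : ℝ) + 1) * deriv h ρ * h ρ ^ m) * (b - a) ≤
      ∫ z in a..b, (-(deriv θ z) + (((m : ℝ) + 1) * deriv h (r z) * f (r z)
        + deriv f (r z) * h (r z)) / h (r z)) * h (r z) ^ (m + 1) := by
    have hθ'c : ContinuousOn (deriv θ) (Set.Icc a b) :=
      (hθ.continuousOn_deriv_of_isOpen hopen le_rfl).mono hfr
    refine const_mul_sub_le_integral_of_sub_deriv_le (θ := θ) (θ' := deriv θ)
      (H := fun z => h (r z) ^ (m + 1))
      (H' := fun z => ((m : ℝ) + 1) * h (r z) ^ m * (deriv h (r z) * deriv r z))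
      hab.le ?_ ?_ hθ'c ?_ ?_ ?_ ?_ ?_
    · intro z hz
      exact ((hθ.contDiffAt (hopen.mem_nhds (hfr z hz))).differentiableAt (by simp)).hasDerivAt
    · intro z _
      simpa using ((hhd (r z)).hasDerivAt.comp z (hrd z).hasDerivAt).fun_pow (m + 1)
    · exact ((continuous_const.mul (hhrc.pow m)).mul
        ((hhc'.comp hr.continuous).mul hr'.continuous)).continuousOn
    · refine (hθ'c.neg.add (ContinuousOn.div ?_ hhrc.continuousOn fun z hz => (hhr z hz).ne')).mul
        (hhrc.pow _).continuousOn
      exact (((continuous_const.mul (hhc'.comp hr.continuous)).mul hfrc).add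
        ((hfc'.comp hr.continuous).mul hhrc)).continuousOn
    · simp [hθdef, hra]
    · simp [hθdef, hrb]
    · intro z hz
      have hh0z := hhr z hz
      have hrz := (hrpos z hz).le
      have hρz := (hrange z hz).1
      have hθr : 0 ≤ θ z * deriv r z := arctan_div_mul_self_nonneg (hfr z hz)
      have hh'z : 0 ≤ deriv h (r z) := zero_le_one.trans (hh'1 _ hrz)
      have hmain : ((m : ℝ) + 1) * deriv h ρ * h ρ ^ m ≤
          ((m : ℝ) + 1) * (deriv h (r z) * f (r z)) * h (r z) ^ m := by
        gcongr
        · exact mul_nonneg (by positivity) (mul_nonneg hh'z (hfr z hz).le)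
        · exact (hmono_h' hρ.le hrz hρz).trans (le_mul_of_one_le_right hh'z (hf1 _ hrz))
        · exact hmono_h hρ.le hrz hρz
      have h1 : 0 ≤ deriv f (r z) * h (r z) ^ (m + 1) := mul_nonneg (hf' _ hrz) (by positivity)
      have h2 : 0 ≤ ((m : ℝ) + 1) * h (r z) ^ m * deriv h (r z) * (θ z * deriv r z) :=
        mul_nonneg (by positivity) hθr
      have h3 : (((m : ℝ) + 1) * deriv h (r z) * f (r z) + deriv f (r z) * h (r z)) / h (r z)
          * h (r z) ^ (m + 1) = ((m : ℝ) + 1) * (deriv h (r z) * f (r z)) * h (r z) ^ m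
            + deriv f (r z) * h (r z) ^ (m + 1) := by
        field_simp
        ring
      rw [add_mul (-deriv θ z), h3]
      linarith
  have hba : 0 < b - a := sub_pos.2 hab
  refine ⟨?_, ?_⟩
  · rw [avgH, hcast, hpred, Nat.add_sub_cancel]
    calc σ * (b - a) * ((m : ℝ) + 1) * deriv h ρ * h ρ ^ m / A₀
        = σ / A₀ * ((((m : ℝ) + 1) * deriv h ρ * h ρ ^ m) * (b - a)) := by ring
      _ ≤ σ / area (m + 2) f h σ a b r * ((((m : ℝ) + 1) * deriv h ρ * h ρ ^ m) * (b - a)) := by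
        gcongr
      _ ≤ _ := mul_le_mul_of_nonneg_left hbound (by positivity)
  · rw [hcast]
    positivity
end

section
/- Assume f is non-decreasing on [0,∞). Let r₂ > 0 and let r : [a,b] → (0, r₂] be a C¹ function such that the zero set of r' is exactly {z₁, ..., z_N} with a = z₁ < z₂ < ... < z_N = b, and r is monotone on each subinterval [z_j, z_{j+1}]. Then the length of the generating curve satisfies L(r) = ∫_a^b √(r'(z)² + f(r(z))²) dz ≤ f(r₂)·(b−a) + (N−1)·r₂. -/
open Real Set MeasureTheory Filter

/-- On an interval where a `C¹` function is monotone, its total variation is the absolute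
increment. -/
theorem integral_abs_deriv_of_monotoneOn_or_antitoneOn {r : ℝ → ℝ} (hr : ContDiff ℝ 1 r)
    {c d : ℝ} (hcd : c < d) (hm : MonotoneOn r (Set.Icc c d) ∨ AntitoneOn r (Set.Icc c d)) :
    ∫ w in c..d, |deriv r w| = |r d - r c| := by
  have hdiff : Differentiable ℝ r := hr.differentiable one_ne_zero
  have hcont : Continuous (deriv r) := hr.continuous_deriv le_rfl
  have hftc : ∫ w in c..d, deriv r w = r d - r c :=
    intervalIntegral.integral_deriv_eq_sub (fun x _ => hdiff x)
      (hcont.intervalIntegrable c d)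
  have hwithin : ∀ w ∈ Set.Icc c d, derivWithin r (Set.Icc c d) w = deriv r w := fun w hw =>
    (hdiff w).derivWithin (uniqueDiffOn_Icc hcd w hw)
  have hc := Set.left_mem_Icc.2 hcd.le
  have hd := Set.right_mem_Icc.2 hcd.le
  rcases hm with hm | hm
  · rw [abs_of_nonneg (sub_nonneg.2 (hm hc hd hcd.le)), ← hftc]
    refine intervalIntegral.integral_congr fun w hw => ?_
    rw [Set.uIcc_of_le hcd.le] at hw
    exact abs_of_nonneg (hwithin w hw ▸ hm.derivWithin_nonneg)
  · rw [abs_of_nonpos (sub_nonpos.2 (hm hc hd hcd.le)), ← hftc,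
      ← intervalIntegral.integral_neg]
    refine intervalIntegral.integral_congr fun w hw => ?_
    rw [Set.uIcc_of_le hcd.le] at hw
    exact abs_of_nonpos (hwithin w hw ▸ hm.derivWithin_nonpos)

theorem sqrt_sq_add_sq_le_abs_add {x y : ℝ} (hy : 0 ≤ y) : √(x ^ 2 + y ^ 2) ≤ |x| + y := by
  refine Real.sqrt_le_iff.2 ⟨by positivity, ?_⟩
  nlinarith [sq_abs x, mul_nonneg (abs_nonneg x) hy]

/-- Length bound for the generating curve: if the zero set of r' is exactly
{z₁ < ... < z_N} with z₁ = a, z_N = b, r is piecewise monotone and 0 < r ≤ r₂, then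
L(r) ≤ f(r₂)(b−a) + (N−1)r₂. -/
theorem stmt_12 (n : ℕ) (hn : 2 ≤ n) (f h : ℝ → ℝ)
    (hf : ContDiff ℝ (⊤ : ℕ∞) f) (hh : ContDiff ℝ (⊤ : ℕ∞) h)
    (hfpos : ∀ s : ℝ, 0 ≤ s → 0 < f s) (hhpos : ∀ s : ℝ, 0 < s → 0 < h s)
    (hf0 : f 0 = 1) (hf'0 : deriv f 0 = 0) (hh0 : h 0 = 0) (hh'0 : deriv h 0 = 1)
    (a b : ℝ) (hab : a < b)
    (hfmono : MonotoneOn f (Set.Ici 0))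
    (r₂ : ℝ) (hr₂ : 0 < r₂)
    (r : ℝ → ℝ) (hr : ContDiff ℝ 1 r)
    (hrange : ∀ z ∈ Set.Icc a b, r z ∈ Set.Ioc 0 r₂)
    (N : ℕ) (hN : 2 ≤ N) (z : ℕ → ℝ)
    (hz1 : z 1 = a) (hzN : z N = b)
    (hzmono : ∀ i j : ℕ, 1 ≤ i → i < j → j ≤ N → z i < z j)
    (hzeros : {w ∈ Set.Icc a b | deriv r w = 0} = z '' {i : ℕ | 1 ≤ i ∧ i ≤ N})
    (hpiece : ∀ i : ℕ, 1 ≤ i → i < N →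
        MonotoneOn r (Set.Icc (z i) (z (i + 1)))
        ∨ AntitoneOn r (Set.Icc (z i) (z (i + 1)))) :
    (∫ w in a..b, Real.sqrt ((deriv r w) ^ 2 + (f (r w)) ^ 2))
      ≤ f r₂ * (b - a) + ((N : ℝ) - 1) * r₂ := by
  have hcont : Continuous (deriv r) := hr.continuous_deriv le_rfl
  have hint : ∀ c d : ℝ, IntervalIntegrable (fun w => |deriv r w|) volume c d := fun c d =>
    hcont.abs.intervalIntegrable c d
  have hmem : ∀ i, 1 ≤ i → i ≤ N → z i ∈ Set.Icc a b := by
    intro i h1 h2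
    have hi : z i ∈ {w ∈ Set.Icc a b | deriv r w = 0} := hzeros ▸ ⟨i, ⟨h1, h2⟩, rfl⟩
    exact hi.1
  have hvar : ∀ k, 1 ≤ k → k ≤ N → ∫ w in a..z k, |deriv r w| ≤ ((k : ℝ) - 1) * r₂ := by
    intro k hk
    induction k, hk using Nat.le_induction with
    | base => simp [hz1]
    | succ k hk ih =>
      intro hkN
      have hstep := integral_abs_deriv_of_monotoneOn_or_antitoneOn hr
        (hzmono k (k + 1) hk k.lt_succ_self hkN) (hpiece k hk hkN)
      have h1 := hrange _ (hmem k hk (by omega))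
      have h2 := hrange _ (hmem (k + 1) (by omega) hkN)
      have hincr : |r (z (k + 1)) - r (z k)| ≤ r₂ :=
        abs_le.2 ⟨by linarith [h1.2, h2.1], by linarith [h1.1, h2.2]⟩
      rw [← intervalIntegral.integral_add_adjacent_intervals (hint a (z k))
        (hint (z k) (z (k + 1))), hstep]
      push_cast
      linarith [ih (by omega)]
  have hlength : Continuous fun w => √((deriv r w) ^ 2 + (f (r w)) ^ 2) :=
    ((hcont.pow 2).add ((hf.continuous.comp hr.continuous).pow 2)).sqrt
  calc ∫ w in a..b, √((deriv r w) ^ 2 + (f (r w)) ^ 2)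
      ≤ ∫ w in a..b, (|deriv r w| + f r₂) := by
        refine intervalIntegral.integral_mono_on hab.le (hlength.intervalIntegrable a b)
          ((hint a b).add intervalIntegrable_const) fun w hw => ?_
        have hw' := hrange w hw
        have hfw := hfmono (Set.mem_Ici.2 hw'.1.le) (Set.mem_Ici.2 hr₂.le) hw'.2
        exact (sqrt_sq_add_sq_le_abs_add (hfpos _ hw'.1.le).le).trans (by gcongr)
    _ = (∫ w in a..b, |deriv r w|) + f r₂ * (b - a) := by
        rw [intervalIntegral.integral_add (hint a b) intervalIntegrable_const,
          intervalIntegral.integral_const, smul_eq_mul, mul_comm (b - a)]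
    _ ≤ f r₂ * (b - a) + ((N : ℝ) - 1) * r₂ := by
        have hN' := hvar N (by omega) le_rfl
        rw [hzN] at hN'
        linarith
end

section
/- Assume f and h are non-decreasing on [0,∞). Let r : [a,b] → (0, r₂] be continuous with enclosed volume V = σ ∫_a^b β(r(z)) dz, and define r₃ by β(r₃) = V/(2·(b−a)·σ); assume r₃ < r₂. Then the Lebesgue measure of the set L₃ = {z ∈ [a,b] : r(z) ≥ r₃} satisfies |L₃| ≥ V / (2·σ·f(r₂)·h(r₂)^{n−1}·(r₂ − r₃)) > 0. -/
open Real Set MeasureTheory Filter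

lemma continuous_sBeta_integrand (n : ℕ) {f h : ℝ → ℝ} (hf : Continuous f) (hh : Continuous h) :
    Continuous fun ρ => f ρ * h ρ ^ (n - 1) :=
  hf.mul (hh.pow _)

lemma continuous_sBeta (n : ℕ) {f h : ℝ → ℝ} (hf : Continuous f) (hh : Continuous h) :
    Continuous (sBeta n f h) :=
  intervalIntegral.continuous_primitive
    (fun _ _ => (continuous_sBeta_integrand n hf hh).intervalIntegrable _ _) 0

lemma sBeta_sub_sBeta (n : ℕ) {f h : ℝ → ℝ} (hf : Continuous f) (hh : Continuous h) (s t : ℝ) :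
    sBeta n f h t - sBeta n f h s = ∫ ρ in s..t, f ρ * h ρ ^ (n - 1) :=
  intervalIntegral.integral_interval_sub_left
    ((continuous_sBeta_integrand n hf hh).intervalIntegrable _ _)
    ((continuous_sBeta_integrand n hf hh).intervalIntegrable _ _)

lemma sBeta_lt_sBeta (n : ℕ) {f h : ℝ → ℝ} (hf : Continuous f) (hh : Continuous h)
    (hfpos : ∀ s : ℝ, 0 ≤ s → 0 < f s) (hhpos : ∀ s : ℝ, 0 < s → 0 < h s)
    {s t : ℝ} (hs : 0 ≤ s) (hst : s < t) : sBeta n f h s < sBeta n f h t := by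
  rw [← sub_pos, sBeta_sub_sBeta n hf hh]
  refine intervalIntegral.intervalIntegral_pos_of_pos_on
    ((continuous_sBeta_integrand n hf hh).intervalIntegrable _ _) (fun x hx => ?_) hst
  have hx0 : 0 < x := hs.trans_lt hx.1
  exact mul_pos (hfpos x hx0.le) (pow_pos (hhpos x hx0) _)

lemma sBeta_sub_le (n : ℕ) {f h : ℝ → ℝ} (hf : Continuous f) (hh : Continuous h)
    (hfpos : ∀ s : ℝ, 0 ≤ s → 0 < f s) (hhpos : ∀ s : ℝ, 0 < s → 0 < h s)
    (hfmono : MonotoneOn f (Set.Ici 0)) (hhmono : MonotoneOn h (Set.Ici 0))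
    {s t : ℝ} (hs : 0 < s) (hst : s ≤ t) :
    sBeta n f h t - sBeta n f h s ≤ f t * h t ^ (n - 1) * (t - s) := by
  rw [sBeta_sub_sBeta n hf hh]
  calc ∫ ρ in s..t, f ρ * h ρ ^ (n - 1)
      ≤ ∫ _ in s..t, f t * h t ^ (n - 1) := by
        refine intervalIntegral.integral_mono_on hst
          ((continuous_sBeta_integrand n hf hh).intervalIntegrable _ _)
          intervalIntegrable_const fun x hx => ?_
        have hx0 : 0 < x := hs.trans_le hx.1
        have ht0 : 0 ≤ t := hs.le.trans hst
        exact mul_le_mul (hfmono hx0.le ht0 hx.2)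
          (pow_le_pow_left₀ (hhpos x hx0).le (hhmono hx0.le ht0 hx.2) _)
          (pow_nonneg (hhpos x hx0).le _) (hfpos t ht0).le
    _ = f t * h t ^ (n - 1) * (t - s) := by
        rw [intervalIntegral.integral_const, smul_eq_mul, mul_comm]

/-- A function bounded by `c` off a measurable set `L` and by `c + M` on `L` has integral at most
`(b - a) c + |L| M`. -/
lemma integral_le_of_le_add_indicator {u : ℝ → ℝ} {a b c M : ℝ} {L : Set ℝ} (hab : a ≤ b)
    (hu : IntervalIntegrable u volume a b) (hL : MeasurableSet L) (hLab : L ⊆ Set.Icc a b)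
    (hle : ∀ z ∈ Set.Icc a b, u z ≤ c + L.indicator (fun _ => M) z) :
    ∫ z in a..b, u z ≤ (b - a) * c + (volume L).toReal * M := by
  have hLfin : volume L ≠ ⊤ := measure_ne_top_of_subset hLab isCompact_Icc.measure_ne_top
  have hind : Integrable (L.indicator fun _ => M) :=
    (integrable_indicator_iff hL).2 (integrableOn_const hLfin)
  refine (intervalIntegral.integral_mono_on hab hu
    (intervalIntegrable_const.add hind.intervalIntegrable) hle).trans_eq ?_
  rw [intervalIntegral.integral_add intervalIntegrable_const hind.intervalIntegrable,
    intervalIntegral.integral_const, intervalIntegral.integral_of_le hab,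
    ← integral_Icc_eq_integral_Ioc, setIntegral_indicator hL,
    Set.inter_eq_self_of_subset_right hLab, setIntegral_const]
  simp [Measure.real]

/-- Lower bound for the measure of the set where r ≥ r₃, where β(r₃) = V/(2(b−a)σ). -/
theorem stmt_13 (n : ℕ) (hn : 2 ≤ n) (f h : ℝ → ℝ)
    (hf : ContDiff ℝ (⊤ : ℕ∞) f) (hh : ContDiff ℝ (⊤ : ℕ∞) h)
    (hfpos : ∀ s : ℝ, 0 ≤ s → 0 < f s) (hhpos : ∀ s : ℝ, 0 < s → 0 < h s)
    (hf0 : f 0 = 1) (hf'0 : deriv f 0 = 0) (hh0 : h 0 = 0) (hh'0 : deriv h 0 = 1)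
    (σ : ℝ) (hσ : 0 < σ) (a b : ℝ) (hab : a < b)
    (hfmono : MonotoneOn f (Set.Ici 0)) (hhmono : MonotoneOn h (Set.Ici 0))
    (r₂ : ℝ) (hr₂ : 0 < r₂)
    (r : ℝ → ℝ) (hr : ContinuousOn r (Set.Icc a b))
    (hrange : ∀ z ∈ Set.Icc a b, r z ∈ Set.Ioc 0 r₂)
    (V r₃ : ℝ) (hV : V = encVol n f h σ a b r)
    (hr₃pos : 0 < r₃) (hr₃ : sBeta n f h r₃ = V / (2 * (b - a) * σ))
    (hr₃r₂ : r₃ < r₂) :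
    V / (2 * σ * f r₂ * h r₂ ^ (n - 1) * (r₂ - r₃))
      ≤ (volume {z ∈ Set.Icc a b | r₃ ≤ r z}).toReal
    ∧ 0 < V / (2 * σ * f r₂ * h r₂ ^ (n - 1) * (r₂ - r₃)) := by
  have hfc := hf.continuous
  have hhc := hh.continuous
  have hba : 0 < b - a := sub_pos.2 hab
  have hβ₃ : 0 < sBeta n f h r₃ := by
    simpa [sBeta] using sBeta_lt_sBeta n hfc hhc hfpos hhpos le_rfl hr₃pos
  have hVβ : V = sBeta n f h r₃ * (2 * (b - a) * σ) := by
    rw [hr₃]; field_simp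
  have hVpos : 0 < V := by rw [hVβ]; positivity
  have hf₂ : 0 < f r₂ := hfpos r₂ hr₂.le
  have hh₂ : 0 < h r₂ ^ (n - 1) := pow_pos (hhpos r₂ hr₂) _
  have hr₂₃ : 0 < r₂ - r₃ := sub_pos.2 hr₃r₂
  refine ⟨?_, by positivity⟩
  set L : Set ℝ := {z ∈ Set.Icc a b | r₃ ≤ r z}
  have hmono : StrictMonoOn (sBeta n f h) (Set.Ici 0) := fun s hs t _ hst =>
    sBeta_lt_sBeta n hfc hhc hfpos hhpos hs hst
  have hβ₂ := sBeta_sub_le n hfc hhc hfpos hhpos hfmono hhmono hr₃pos hr₃r₂.le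
  have hL : MeasurableSet L :=
    (hr.preimage_isClosed_of_isClosed isClosed_Icc isClosed_Ici).measurableSet
  have hu : ContinuousOn (fun z => sBeta n f h (r z)) (Set.uIcc a b) := by
    rw [Set.uIcc_of_le hab.le]
    exact (continuous_sBeta n hfc hhc).comp_continuousOn hr
  have hint := integral_le_of_le_add_indicator (c := sBeta n f h r₃)
    (M := f r₂ * h r₂ ^ (n - 1) * (r₂ - r₃)) hab.le hu.intervalIntegrable hL
    (fun z hz => hz.1) fun z hz => by
      obtain ⟨hz₀, hz₂⟩ := hrange z hz
      by_cases hzL : z ∈ L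
      · rw [Set.indicator_of_mem hzL]
        linarith [hmono.monotoneOn hz₀.le hr₂.le hz₂]
      · rw [Set.indicator_of_notMem hzL, add_zero]
        exact hmono.monotoneOn hz₀.le hr₃pos.le (not_le.1 fun hle => hzL ⟨hz, hle⟩).le
  have hσint := mul_le_mul_of_nonneg_left hint hσ.le
  rw [← encVol, ← hV] at hσint
  rw [div_le_iff₀ (by positivity)]
  linarith
end

section
/- Assume h'' ≥ 0 and f'·h' ≥ 0 on [0,∞) (so that f ≥ 1 is non-decreasing and h' ≥ 1 is non-decreasing). Let r : [a,b] → (0, r₂] be C² with r'(a) = r'(b) = 0, with area A(r) ≥ A_V > 0 and with generating-curve length L(r) = ∫_a^b √(r'(z)² + f(r(z))²) dz ≤ c. Then the averaged mean curvature satisfies the upper bound H̄(r) ≤ (σ/A_V)·[ (π/2)·(n−1)·h'(r₂)·h(r₂)^{n−2}·c + (b−a)·max_{s∈[0,r₂]} ((n−1)·h'(s)·f(s) + f'(s)·h(s))·h(s)^{n−2} ]. -/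
open Real Set MeasureTheory Filter

/-- A function with nonnegative second derivative on `[0, ∞)` has monotone derivative there. -/
theorem monotoneOn_deriv_of_deriv2_nonneg {h : ℝ → ℝ} (hh : ContDiff ℝ (⊤ : ℕ∞) h)
    (hconv : ∀ s : ℝ, 0 ≤ s → 0 ≤ deriv (deriv h) s) : MonotoneOn (deriv h) (Ici 0) := by
  have hh2 : ContDiff ℝ 2 h := contDiff_infty.mp hh 2
  have hd : Differentiable ℝ (deriv h) := hh2.differentiable_deriv_two
  refine monotoneOn_of_deriv_nonneg (convex_Ici 0) hd.continuous.continuousOn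
    hd.differentiableOn fun x hx => hconv x ?_
  rw [interior_Ici] at hx
  exact hx.le

/-- The turning angle of the graph of `r` relative to the warped metric has a derivative which is
continuous wherever the warping function does not vanish. -/
theorem exists_continuousOn_hasDerivAt_arctan_div {f r : ℝ → ℝ} {s : Set ℝ}
    (hf : ContDiff ℝ 1 f) (hr : ContDiff ℝ 2 r) (hs : ∀ z ∈ s, f (r z) ≠ 0) :
    ∃ g : ℝ → ℝ, ContinuousOn g s ∧
      ∀ z ∈ s, HasDerivAt (fun w => arctan (deriv r w / f (r w))) (g z) z := by
  have hr1 : Differentiable ℝ r := hr.differentiable (by norm_num)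
  have hr2 : Differentiable ℝ (deriv r) := hr.differentiable_deriv_two
  have hr' : Continuous (deriv r) := hr2.continuous
  have hr'' : Continuous (deriv (deriv r)) := by
    have h1 : ContDiff ℝ 1 (deriv r) := by
      have h2 : ContDiff ℝ (1 + 1) r := by simpa [one_add_one_eq_two] using hr
      exact (contDiff_succ_iff_deriv.mp h2).2.2
    exact h1.continuous_deriv le_rfl
  have hfr : Continuous fun z => f (r z) := hf.continuous.comp hr1.continuous
  have hf'r : Continuous fun z => deriv f (r z) :=
    (hf.continuous_deriv le_rfl).comp hr1.continuous
  refine ⟨fun z => 1 / (1 + (deriv r z / f (r z)) ^ 2) *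
    ((deriv (deriv r) z * f (r z) - deriv r z * (deriv f (r z) * deriv r z)) / f (r z) ^ 2),
    ?_, fun z hz => ?_⟩
  · refine ContinuousOn.mul (ContinuousOn.div continuousOn_const ?_ fun z _ => by positivity)
      (ContinuousOn.div ?_ (hfr.pow 2).continuousOn
        fun z hz => pow_ne_zero 2 (hs z hz))
    · exact continuousOn_const.add ((hr'.continuousOn.div hfr.continuousOn hs).pow 2)
    · exact ((hr''.mul hfr).sub (hr'.mul (hf'r.mul hr'))).continuousOn
  · have hfz : HasDerivAt (fun w => f (r w)) (deriv f (r z) * deriv r z) z :=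
      ((hf.differentiable one_ne_zero) (r z)).hasDerivAt.comp z (hr1 z).hasDerivAt
    exact ((hr2 z).hasDerivAt.div hfz (hs z hz)).arctan

/-- Finer upper bound for the averaged mean curvature in terms of a lower area bound
A_V and an upper bound c for the length of the generating curve. -/
theorem stmt_14 (n : ℕ) (hn : 2 ≤ n) (f h : ℝ → ℝ)
    (hf : ContDiff ℝ (⊤ : ℕ∞) f) (hh : ContDiff ℝ (⊤ : ℕ∞) h)
    (hfpos : ∀ s : ℝ, 0 ≤ s → 0 < f s) (hhpos : ∀ s : ℝ, 0 < s → 0 < h s)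
    (hf0 : f 0 = 1) (hf'0 : deriv f 0 = 0) (hh0 : h 0 = 0) (hh'0 : deriv h 0 = 1)
    (σ : ℝ) (hσ : 0 < σ) (a b : ℝ) (hab : a < b)
    (hSri : ∀ s : ℝ, 0 ≤ s → 0 ≤ deriv (deriv h) s)
    (hSzi : ∀ s : ℝ, 0 ≤ s → 0 ≤ deriv f s * deriv h s)
    (r₂ A_V c : ℝ) (hr₂ : 0 < r₂) (hA_V : 0 < A_V)
    (r : ℝ → ℝ) (hr : ContDiff ℝ 2 r)
    (hrange : ∀ z ∈ Set.Icc a b, r z ∈ Set.Ioc 0 r₂)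
    (hra : deriv r a = 0) (hrb : deriv r b = 0)
    (harea : A_V ≤ area n f h σ a b r)
    (hlen : (∫ w in a..b, Real.sqrt ((deriv r w) ^ 2 + (f (r w)) ^ 2)) ≤ c) :
    avgH n f h σ a b r ≤
      (σ / A_V) * ((Real.pi / 2) * ((n : ℝ) - 1) * deriv h r₂ * h r₂ ^ (n - 2) * c
        + (b - a) * sSup ((fun s =>
            (((n : ℝ) - 1) * deriv h s * f s + deriv f s * h s) * h s ^ (n - 2))
              '' Set.Icc 0 r₂)) := by
  have hf1 : ContDiff ℝ 1 f := hf.of_le (by exact_mod_cast le_top)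
  have hh1 : ContDiff ℝ 1 h := hh.of_le (by exact_mod_cast le_top)
  have hn1 : (0 : ℝ) ≤ (n : ℝ) - 1 := by
    have : (2 : ℝ) ≤ n := by exact_mod_cast hn
    linarith
  have hfc : Continuous f := hf1.continuous
  have hhc : Continuous h := hh1.continuous
  have hf'c : Continuous (deriv f) := hf1.continuous_deriv le_rfl
  have hh'c : Continuous (deriv h) := hh1.continuous_deriv le_rfl
  have hhd : Differentiable ℝ h := hh1.differentiable one_ne_zero
  have hrd : Differentiable ℝ r := hr.differentiable (by norm_num)
  have hrc : Continuous r := hrd.continuous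
  have hr'c : Continuous (deriv r) := hr.differentiable_deriv_two.continuous
  have hh'mono := monotoneOn_deriv_of_deriv2_nonneg hh hSri
  have hh'one : ∀ s, 0 ≤ s → 1 ≤ deriv h s := fun s hs =>
    hh'0 ▸ hh'mono self_mem_Ici hs hs
  have hhmono : MonotoneOn h (Ici 0) := by
    refine monotoneOn_of_deriv_nonneg (convex_Ici 0) hhc.continuousOn
      hhd.differentiableOn fun x hx => ?_
    rw [interior_Ici] at hx
    linarith [hh'one x hx.le]
  have hf'nn : ∀ s, 0 ≤ s → 0 ≤ deriv f s := fun s hs =>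
    nonneg_of_mul_nonneg_left (hSzi s hs) (by linarith [hh'one s hs])
  set F : ℝ → ℝ := fun s =>
    (((n : ℝ) - 1) * deriv h s * f s + deriv f s * h s) * h s ^ (n - 2) with hF
  set M := sSup (F '' Icc 0 r₂)
  have hFc : Continuous F := by fun_prop
  have hFM : ∀ s ∈ Icc 0 r₂, F s ≤ M := fun s hs =>
    le_csSup (isCompact_Icc.image hFc).bddAbove (mem_image_of_mem F hs)
  have hM0 : 0 ≤ M := by
    refine le_trans ?_ (hFM r₂ ⟨hr₂.le, le_rfl⟩)
    have h1 := hh'one r₂ hr₂.le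
    have h2 := hf'nn r₂ hr₂.le
    have h3 := hfpos r₂ hr₂.le
    have h4 := hhpos r₂ hr₂
    have h5 : 0 ≤ deriv h r₂ := by linarith
    positivity
  set K := π / 2 * ((n : ℝ) - 1) * deriv h r₂ * h r₂ ^ (n - 2) with hK
  have hK0 : 0 ≤ K := by
    have h4 := hhpos r₂ hr₂
    have h5 : 0 ≤ deriv h r₂ := by linarith [hh'one r₂ hr₂.le]
    positivity
  have hc0 : 0 ≤ c :=
    (intervalIntegral.integral_nonneg hab.le fun _ _ => Real.sqrt_nonneg _).trans hlen
  obtain ⟨g, hgc, hg⟩ := exists_continuousOn_hasDerivAt_arctan_div (s := Icc a b) hf1 hr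
    fun z hz => (hfpos _ (hrange z hz).1.le).ne'
  have hgi : IntervalIntegrable g volume a b := hgc.intervalIntegrable_of_Icc hab.le
  set u : ℝ → ℝ := fun w => arctan (deriv r w / f (r w)) with hu
  set v' : ℝ → ℝ := fun z =>
    ((n - 1 : ℕ) : ℝ) * h (r z) ^ (n - 1 - 1) * (deriv h (r z) * deriv r z) with hv'
  have hv : ∀ z, HasDerivAt (fun w => h (r w) ^ (n - 1)) (v' z) z := fun z =>
    ((hhd (r z)).hasDerivAt.comp z (hrd z).hasDerivAt).pow (n - 1)
  have hv'c : Continuous v' := by fun_prop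
  have huc : ContinuousOn u (Icc a b) := fun z hz => (hg z hz).continuousAt.continuousWithinAt
  have hparts : ∫ z in a..b, g z * h (r z) ^ (n - 1) = -∫ z in a..b, u z * v' z := by
    have := intervalIntegral.integral_deriv_mul_eq_sub
      (u := u) (v := fun w => h (r w) ^ (n - 1)) (u' := g) (v' := v') (a := a) (b := b)
      (fun z hz => hg z (by rwa [uIcc_of_le hab.le] at hz)) (fun z _ => hv z) hgi
      (hv'c.intervalIntegrable _ _)
    have hua : u a = 0 := by simp [hu, hra]
    have hub : u b = 0 := by simp [hu, hrb]
    rw [hua, hub, intervalIntegral.integral_add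
      (hgi.mul_continuousOn (by fun_prop))
      ((hv'c.intervalIntegrable _ _).continuousOn_mul (by rwa [uIcc_of_le hab.le]))] at this
    linarith
  have hint : (∫ z in a..b,
      (-(deriv u z)
        + (((n : ℝ) - 1) * deriv h (r z) * f (r z) + deriv f (r z) * h (r z)) / h (r z))
        * h (r z) ^ (n - 1)) = (∫ z in a..b, u z * v' z) + ∫ z in a..b, F (r z) := by
    have hcongr : EqOn (fun z => (-(deriv u z)
        + (((n : ℝ) - 1) * deriv h (r z) * f (r z) + deriv f (r z) * h (r z)) / h (r z))
        * h (r z) ^ (n - 1)) (fun z => -(g z * h (r z) ^ (n - 1)) + F (r z)) (uIcc a b) := by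
      intro z hz
      rw [uIcc_of_le hab.le] at hz
      have hne := (hhpos _ (hrange z hz).1).ne'
      have hpow : h (r z) ^ (n - 1) = h (r z) ^ (n - 2) * h (r z) := by
        rw [← pow_succ]
        congr 1
        omega
      simp only [hF]
      rw [(hg z hz).deriv, hpow]
      field_simp
    have hgv : IntervalIntegrable (fun z => -(g z * h (r z) ^ (n - 1))) volume a b :=
      (hgi.mul_continuousOn (by fun_prop)).neg
    have hFr : IntervalIntegrable (fun z => F (r z)) volume a b :=
      (hFc.comp hrc).intervalIntegrable _ _
    rw [intervalIntegral.integral_congr hcongr, intervalIntegral.integral_add hgv hFr,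
      intervalIntegral.integral_neg, hparts, neg_neg]
  have hbound1 : (∫ z in a..b, u z * v' z) ≤ K * c := by
    have hlenc : Continuous fun w => √((deriv r w) ^ 2 + (f (r w)) ^ 2) := by fun_prop
    calc (∫ z in a..b, u z * v' z)
        ≤ ∫ z in a..b, K * √((deriv r z) ^ 2 + (f (r z)) ^ 2) := by
          refine intervalIntegral.integral_mono_on hab.le
            ((hv'c.intervalIntegrable _ _).continuousOn_mul (by rwa [uIcc_of_le hab.le]))
            ((hlenc.const_mul K).intervalIntegrable _ _) fun z hz => ?_
          obtain ⟨hr0, hrr₂⟩ := hrange z hz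
          have hu_le : |u z| ≤ π / 2 :=
            abs_le.mpr ⟨(neg_pi_div_two_lt_arctan _).le, (arctan_lt_pi_div_two _).le⟩
          have hr'le : |deriv r z| ≤ √((deriv r z) ^ 2 + (f (r z)) ^ 2) :=
            abs_le_sqrt (by nlinarith [sq_nonneg (f (r z))])
          have hhle : h (r z) ≤ h r₂ := hhmono hr0.le hr₂.le hrr₂
          have hh'le : deriv h (r z) ≤ deriv h r₂ := hh'mono hr0.le hr₂.le hrr₂
          have hhz := (hhpos _ hr0).le
          have hh'z : 0 ≤ deriv h (r z) := by linarith [hh'one _ hr0.le]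
          have hh'r₂ : 0 ≤ deriv h r₂ := hh'z.trans hh'le
          have hhr₂ := (hhpos _ hr₂).le
          have hcast : ((n - 1 : ℕ) : ℝ) = (n : ℝ) - 1 := by
            rw [Nat.cast_sub (by omega), Nat.cast_one]
          have hv'abs : |v' z| =
              ((n : ℝ) - 1) * h (r z) ^ (n - 2) * (deriv h (r z) * |deriv r z|) := by
            simp only [hv', hcast, Nat.sub_sub, Nat.reduceAdd, abs_mul, abs_of_nonneg hn1,
              abs_of_nonneg hh'z, abs_of_nonneg (pow_nonneg hhz (n - 2))]
          calc u z * v' z ≤ |u z| * |v' z| := (le_abs_self _).trans (abs_mul _ _).le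
            _ ≤ π / 2 * (((n : ℝ) - 1) * h r₂ ^ (n - 2) *
                  (deriv h r₂ * √((deriv r z) ^ 2 + (f (r z)) ^ 2))) := by
                rw [hv'abs]
                gcongr
            _ = K * √((deriv r z) ^ 2 + (f (r z)) ^ 2) := by rw [hK]; ring
      _ = K * ∫ z in a..b, √((deriv r z) ^ 2 + (f (r z)) ^ 2) :=
          intervalIntegral.integral_const_mul _ _
      _ ≤ K * c := mul_le_mul_of_nonneg_left hlen hK0
  have hbound2 : (∫ z in a..b, F (r z)) ≤ (b - a) * M := by
    calc (∫ z in a..b, F (r z)) ≤ ∫ _ in a..b, M :=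
          intervalIntegral.integral_mono_on hab.le ((hFc.comp hrc).intervalIntegrable _ _)
            intervalIntegrable_const fun z hz =>
              hFM _ ⟨(hrange z hz).1.le, (hrange z hz).2⟩
      _ = (b - a) * M := by rw [intervalIntegral.integral_const, smul_eq_mul]
  have hA : 0 < area n f h σ a b r := hA_V.trans_le harea
  have hba : 0 ≤ b - a := sub_nonneg.mpr hab.le
  rw [avgH, hint]
  calc σ / area n f h σ a b r * ((∫ z in a..b, u z * v' z) + ∫ z in a..b, F (r z))
      ≤ σ / area n f h σ a b r * (K * c + (b - a) * M) := by gcongr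
    _ ≤ σ / A_V * (K * c + (b - a) * M) := by gcongr
end

section
/- Let r : [a,b] → [0,∞) be C¹ with enclosed volume V = σ ∫_a^b β(r(z)) dz > 0, define r₁ by β(r₁) = V/((b−a)·σ), and suppose r(z₀) = 0 for some z₀ ∈ [a,b]. Then the area satisfies the strict inequality A(r) > σ·δ(r₁) = (V/(b−a))·(δ(r₁)/β(r₁)). -/
open Real Set MeasureTheory Filter

/-- The primitive based at `0` of a continuous function that is positive on `(0, ∞)` is strictly
increasing on `[0, ∞)`. -/
theorem strictMonoOn_integral_of_pos {g : ℝ → ℝ} (hg : Continuous g)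
    (hpos : ∀ s, 0 < s → 0 < g s) :
    StrictMonoOn (fun s => ∫ ρ in (0 : ℝ)..s, g ρ) (Ici 0) := by
  intro x hx y _ hxy
  have hlt : 0 < ∫ ρ in x..y, g ρ :=
    intervalIntegral.intervalIntegral_pos_of_pos_on (hg.intervalIntegrable _ _)
      (fun ρ hρ => hpos ρ (lt_of_le_of_lt hx hρ.1)) hxy
  have hadd := intervalIntegral.integral_add_adjacent_intervals
    (hg.intervalIntegrable (μ := volume) 0 x) (hg.intervalIntegrable x y)
  change (∫ ρ in (0 : ℝ)..x, g ρ) < ∫ ρ in (0 : ℝ)..y, g ρ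
  linarith

/-- A continuous function that is somewhere below a constant `c`, and whose integral is that of
`c`, is somewhere above `c`. -/
theorem exists_lt_of_integral_eq_const {u : ℝ → ℝ} {a b c z₀ : ℝ} (hab : a < b)
    (hu : Continuous u) (hz₀ : z₀ ∈ Icc a b) (hlt : u z₀ < c)
    (hint : ∫ z in a..b, u z = (b - a) * c) :
    ∃ z ∈ Icc a b, c < u z := by
  by_contra! hle
  have := intervalIntegral.integral_lt_integral_of_continuousOn_of_le_of_exists_lt hab
    hu.continuousOn (continuousOn_const (c := c))
    (fun z hz => hle z (Ioc_subset_Icc_self hz)) ⟨z₀, hz₀, hlt⟩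
  simp only [intervalIntegral.integral_const, smul_eq_mul] at this
  linarith

/-- The integral of a nonnegative weight between two values of a `C¹` function is at most the
weighted total variation, hence at most the weighted length. -/
theorem integral_le_integral_sqrt_mul {g F r : ℝ → ℝ} {a b z₀ z₁ : ℝ} (hab : a ≤ b)
    (hg : Continuous g) (hF : Continuous F) (hr : ContDiff ℝ 1 r)
    (hg_nonneg : ∀ z ∈ Icc a b, 0 ≤ g (r z)) (hz₀ : z₀ ∈ Icc a b) (hz₁ : z₁ ∈ Icc a b) :
    ∫ ρ in r z₀..r z₁, g ρ ≤ ∫ z in a..b, √(deriv r z ^ 2 + F (r z) ^ 2) * g (r z) := by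
  have hr' : Continuous (deriv r) := hr.continuous_deriv le_rfl
  have hcont : Continuous fun z => √(deriv r z ^ 2 + F (r z) ^ 2) * g (r z) := by
    have := hr.continuous
    fun_prop
  have hsub : uIoc z₀ z₁ ⊆ Ioc a b := by
    rw [uIoc]
    exact Ioc_subset_Ioc (le_min hz₀.1 hz₁.1) (max_le hz₀.2 hz₁.2)
  have hnonneg : ∀ z ∈ Ioc a b, 0 ≤ √(deriv r z ^ 2 + F (r z) ^ 2) * g (r z) := fun z hz =>
    mul_nonneg (Real.sqrt_nonneg _) (hg_nonneg z (Ioc_subset_Icc_self hz))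
  have hintegrable : IntegrableOn (fun z => √(deriv r z ^ 2 + F (r z) ^ 2) * g (r z)) (Ioc a b) :=
    hcont.integrableOn_Ioc
  rw [← intervalIntegral.integral_comp_mul_deriv (f := r) (f' := deriv r)
    (fun z _ => (hr.differentiable one_ne_zero z).hasDerivAt) hr'.continuousOn hg]
  calc ∫ z in z₀..z₁, (g ∘ r) z * deriv r z
      ≤ ‖∫ z in z₀..z₁, (g ∘ r) z * deriv r z‖ := Real.le_norm_self _
    _ ≤ ∫ z in uIoc z₀ z₁, ‖(g ∘ r) z * deriv r z‖ :=
        intervalIntegral.norm_integral_le_integral_norm_uIoc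
    _ ≤ ∫ z in uIoc z₀ z₁, √(deriv r z ^ 2 + F (r z) ^ 2) * g (r z) := by
        refine setIntegral_mono_on ?_ (hintegrable.mono_set hsub) measurableSet_uIoc ?_
        · have hcont' : Continuous fun z => ‖(g ∘ r) z * deriv r z‖ :=
            ((hg.comp hr.continuous).mul hr').norm
          exact (hcont'.integrableOn_Ioc (a := a) (b := b)).mono_set hsub
        · intro z hz
          have hgz := hg_nonneg z (Ioc_subset_Icc_self (hsub hz))
          rw [Function.comp_apply, norm_mul, Real.norm_of_nonneg hgz, mul_comm]
          exact mul_le_mul_of_nonneg_right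
            (Real.abs_le_sqrt (le_add_of_nonneg_right (sq_nonneg _))) hgz
    _ ≤ ∫ z in Ioc a b, √(deriv r z ^ 2 + F (r z) ^ 2) * g (r z) :=
        setIntegral_mono_set hintegrable
          ((ae_restrict_iff' measurableSet_Ioc).2 (Eventually.of_forall hnonneg))
          hsub.eventuallyLE
    _ = ∫ z in a..b, √(deriv r z ^ 2 + F (r z) ^ 2) * g (r z) :=
        (intervalIntegral.integral_of_le hab).symm

/-- If the generating curve touches the axis (r(z₀) = 0 for some z₀), then
A(r) > σδ(r₁) = (V/(b−a))·(δ(r₁)/β(r₁)), where β(r₁) = V/((b−a)σ). -/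
theorem stmt_17 (n : ℕ) (hn : 2 ≤ n) (f h : ℝ → ℝ)
    (hf : ContDiff ℝ (⊤ : ℕ∞) f) (hh : ContDiff ℝ (⊤ : ℕ∞) h)
    (hfpos : ∀ s : ℝ, 0 ≤ s → 0 < f s) (hhpos : ∀ s : ℝ, 0 < s → 0 < h s)
    (hf0 : f 0 = 1) (hf'0 : deriv f 0 = 0) (hh0 : h 0 = 0) (hh'0 : deriv h 0 = 1)
    (σ : ℝ) (hσ : 0 < σ) (a b : ℝ) (hab : a < b)
    (r : ℝ → ℝ) (hr : ContDiff ℝ 1 r)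
    (hrnonneg : ∀ z ∈ Set.Icc a b, 0 ≤ r z)
    (V r₁ : ℝ) (hV : V = encVol n f h σ a b r) (hVpos : 0 < V)
    (hr₁pos : 0 < r₁) (hr₁ : sBeta n f h r₁ = V / ((b - a) * σ))
    (z₀ : ℝ) (hz₀ : z₀ ∈ Set.Icc a b) (hz₀zero : r z₀ = 0) :
    σ * sDelta n h r₁ < area n f h σ a b r
    ∧ σ * sDelta n h r₁ = (V / (b - a)) * (sDelta n h r₁ / sBeta n f h r₁) := by
  have hfc := hf.continuous
  have hhc := hh.continuous
  have hrc := hr.continuous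
  have hgc : Continuous fun ρ => h ρ ^ (n - 1) := hhc.pow _
  have hfgc : Continuous fun ρ => f ρ * h ρ ^ (n - 1) := hfc.mul hgc
  have hβ : StrictMonoOn (sBeta n f h) (Ici 0) := strictMonoOn_integral_of_pos hfgc
    fun s hs => mul_pos (hfpos s hs.le) (pow_pos (hhpos s hs) _)
  have hδ : StrictMonoOn (sDelta n h) (Ici 0) := strictMonoOn_integral_of_pos hgc
    fun s hs => pow_pos (hhpos s hs) _
  have hba : b - a ≠ 0 := (sub_pos.2 hab).ne'
  have hβcont : Continuous (sBeta n f h) :=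
    intervalIntegral.continuous_primitive (fun _ _ => hfgc.intervalIntegrable _ _) 0
  have hmean : ∫ z in a..b, sBeta n f h (r z) = (b - a) * sBeta n f h r₁ := by
    rw [hr₁, hV, encVol]
    field_simp
  obtain ⟨z₁, hz₁, hlt⟩ := exists_lt_of_integral_eq_const hab (hβcont.comp hrc) hz₀
    (by simpa [hz₀zero] using hβ self_mem_Ici hr₁pos.le hr₁pos) hmean
  have hr₁lt : r₁ < r z₁ := (hβ.lt_iff_lt hr₁pos.le (hrnonneg z₁ hz₁)).1 hlt
  have hh_nonneg : ∀ s, 0 ≤ s → 0 ≤ h s := fun s hs =>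
    hs.eq_or_lt.elim (fun h0 => by rw [← h0, hh0]) fun hs => (hhpos s hs).le
  refine ⟨mul_lt_mul_of_pos_left ?_ hσ, ?_⟩
  · refine (hδ hr₁pos.le (hrnonneg z₁ hz₁) hr₁lt).trans_le ?_
    have := integral_le_integral_sqrt_mul hab.le hgc hfc hr
      (fun z hz => pow_nonneg (hh_nonneg _ (hrnonneg z hz)) _) hz₀ hz₁
    rwa [hz₀zero] at this
  · rw [hr₁]
    field_simp
end
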